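/- arXiv:2110.11169 — 4 statements merged into one kernel-verified Lean document; each statement's English description precedes it below -/
import Mathlib

section
/- Let 1 ≤ k ≤ n and let λ ∈ Γ_k ⊂ ℝ^n. Then for every index i with 1 ≤ i ≤ n, one has σ_{k-1,i}(λ) > 0, where σ_{k-1,i}(λ) denotes the (k-1)-st elementary symmetric polynomial of the (n-1)-tuple obtained from λ by deleting the entry λ_i. -/
open Finset

/-- The `k`-th elementary symmetric polynomial of the values of `lam` on the index set `S`. -/
noncomputable def esymmOn {n : ℕ} (S : Finset (Fin n)) (k : ℕ) (lam : Fin n → ℝ) : ℝ :=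
  ∑ s ∈ S.powersetCard k, ∏ i ∈ s, lam i

/-- The `k`-th elementary symmetric polynomial `σ_k` on `ℝ^n`. -/
noncomputable def sigmaK (n k : ℕ) (lam : Fin n → ℝ) : ℝ :=
  esymmOn (Finset.univ : Finset (Fin n)) k lam

/-- The Gårding cone `Γ_k = {λ : σ_1(λ) > 0, …, σ_k(λ) > 0}`. -/
def GardingCone (n k : ℕ) : Set (Fin n → ℝ) :=
  {lam | ∀ j, 1 ≤ j → j ≤ k → 0 < sigmaK n j lam}

open Polynomial in
/-- The generating polynomial. -/
noncomputable def genPoly {n : ℕ} (S : Finset (Fin n)) (lam : Fin n → ℝ) : ℝ[X] :=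
  ∏ i ∈ S, (1 + C (lam i) * X)

open Polynomial in
theorem genPoly_coeff {n : ℕ} (S : Finset (Fin n)) (lam : Fin n → ℝ) (j : ℕ) :
    (genPoly S lam).coeff j = esymmOn S j lam := by
  unfold genPoly esymmOn
  rw [Finset.prod_one_add, finset_sum_coeff, Finset.powersetCard_eq_filter, Finset.sum_filter]
  refine Finset.sum_congr rfl fun t _ => ?_
  rw [Finset.prod_mul_distrib, Finset.prod_const, ← map_prod, coeff_C_mul_X_pow]
  simp only [eq_comm]

open Polynomial in
theorem genPoly_splits {n : ℕ} (S : Finset (Fin n)) (lam : Fin n → ℝ) :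
    (genPoly S lam).Splits := by
  unfold genPoly
  refine Splits.prod fun i _ => Splits.of_natDegree_le_one ?_
  compute_degree

open Polynomial in
theorem splits_deriv {p : ℝ[X]} (hp : p.Splits) : (derivative p).Splits := by
  rcases Nat.eq_zero_or_pos p.natDegree with h | h
  · rw [derivative_of_natDegree_zero h]; exact Splits.zero
  · rw [splits_iff_card_roots] at hp ⊢
    have h1 := card_roots_le_derivative p
    have h2 := card_roots' (derivative p)
    have h3 := natDegree_derivative_lt h.ne'
    omega

open Polynomial in
theorem laguerre {p : ℝ[X]} (hp : p.Splits) (x : ℝ) :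
    p.eval x * (derivative (derivative p)).eval x ≤ (derivative p).eval x ^ 2 := by
  rw [hp.eq_prod_roots]
  generalize p.roots = s
  induction s using Multiset.induction_on with
  | empty => simp
  | cons a s ih =>
    rw [Multiset.map_cons, Multiset.prod_cons, mul_left_comm]
    generalize C p.leadingCoeff * (Multiset.map (fun a => X - C a) s).prod = g at ih ⊢
    simp only [derivative_mul, derivative_sub, derivative_X, derivative_C, derivative_add,
      eval_add, eval_mul, eval_sub, eval_X, eval_C, eval_one, eval_zero, sub_zero, one_mul]
    nlinarith [sq_nonneg (eval x g), mul_le_mul_of_nonneg_left ih (sq_nonneg (x - a))]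

open Polynomial in
theorem newton_coeff (j : ℕ) : ∀ {p : ℝ[X]}, p.Splits →
    ((j : ℝ) + 2) * (p.coeff j * p.coeff (j + 2)) ≤ (j + 1) * p.coeff (j + 1) ^ 2 := by
  intro p hp
  have hs : (derivative^[j] p).Splits := by
    clear * - hp
    induction j with
    | zero => exact hp
    | succ j ih => rw [Function.iterate_succ_apply']; exact splits_deriv ih
  have h := laguerre hs 0
  rw [← Function.iterate_succ_apply' derivative, ← Function.iterate_succ_apply' derivative,
    ← coeff_zero_eq_eval_zero, ← coeff_zero_eq_eval_zero, ← coeff_zero_eq_eval_zero,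
    coeff_iterate_derivative, coeff_iterate_derivative, coeff_iterate_derivative] at h
  simp only [zero_add, Nat.descFactorial_self, nsmul_eq_mul, Nat.succ_eq_add_one,
    Nat.factorial_succ] at h
  push_cast at h
  have hf : (0 : ℝ) < (j.factorial : ℝ) := by positivity
  have hc : (0 : ℝ) < (j.factorial : ℝ) ^ 2 * (j + 1) := by positivity
  refine le_of_mul_le_mul_left ?_ hc
  ring_nf at h ⊢
  linarith

open Polynomial in
theorem esymm_rec {n : ℕ} (lam : Fin n → ℝ) (i : Fin n) (j : ℕ) :
    sigmaK n (j + 1) lam = esymmOn (Finset.univ.erase i) (j + 1) lam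
      + lam i * esymmOn (Finset.univ.erase i) j lam := by
  unfold sigmaK
  rw [← genPoly_coeff, ← genPoly_coeff, ← genPoly_coeff]
  have : genPoly Finset.univ lam = (1 + C (lam i) * X) * genPoly (Finset.univ.erase i) lam :=
    (Finset.mul_prod_erase _ _ (Finset.mem_univ i)).symm
  rw [this, add_mul, one_mul, coeff_add, mul_assoc, coeff_C_mul, coeff_X_mul]

theorem del_aux {n : ℕ} (lam : Fin n → ℝ) (i : Fin n) (m : ℕ) :
    (∀ j, 1 ≤ j → j ≤ m + 1 → 0 < sigmaK n j lam) →
      0 < esymmOn (Finset.univ.erase i) m lam := by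
  induction m with
  | zero => intro _; simp [esymmOn]
  | succ m ih =>
    intro h
    have ha := ih fun j h1 h2 => h j h1 (by omega)
    have h1 := h (m + 1) (by omega) (by omega)
    have h2 := h (m + 2) (by omega) (by omega)
    rw [esymm_rec lam i] at h1 h2
    have hN := newton_coeff m (genPoly_splits (Finset.univ.erase i) lam)
    simp only [genPoly_coeff] at hN
    simp only [add_assoc, Nat.reduceAdd] at h2 hN
    generalize esymmOn (Finset.univ.erase i) m lam = a at *
    generalize esymmOn (Finset.univ.erase i) (m + 1) lam = b at *
    generalize esymmOn (Finset.univ.erase i) (m + 2) lam = c at *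
    by_contra hb
    push Not at hb
    have hm : (0 : ℝ) ≤ m := m.cast_nonneg
    have e1 : 0 < a * (c + lam i * b) := mul_pos ha h2
    have e2 : 0 ≤ (-b) * (b + lam i * a) := mul_nonneg (by linarith) h1.le
    have e3 : b ^ 2 < a * c := by nlinarith
    nlinarith [sq_nonneg b, mul_lt_mul_of_pos_left e3 (show (0 : ℝ) < m + 1 by linarith)]

/-- If `1 ≤ k ≤ n` and `lam ∈ Γ_k`, then for every index `i`,
`σ_{k-1,i}(lam) > 0`, where `σ_{k-1,i}` is `σ_{k-1}` of the tuple with the `i`-th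
entry deleted. -/
theorem sigma_del_pos (n k : ℕ) (hk1 : 1 ≤ k) (hkn : k ≤ n)
    (lam : Fin n → ℝ) (hlam : lam ∈ GardingCone n k) :
    ∀ i : Fin n, 0 < esymmOn (Finset.univ.erase i) (k - 1) lam := by
  intro i
  exact del_aux lam i (k - 1) fun j h1 h2 => hlam j h1 (by omega)
end

section
/- (Gårding's inequality) Let 1 ≤ k ≤ n. There exists a constant C(n,k) > 0 depending only on n and k such that for all μ, λ ∈ Γ_k ⊂ ℝ^n, Σ_{i=1}^n μ_i σ_{k-1,i}(λ) ≥ C(n,k) · σ_k(μ)^{1/k} · σ_k(λ)^{(k-1)/k}, where σ_{k-1,i}(λ) = ∂σ_k/∂λ_i is the (k-1)-st elementary symmetric polynomial of λ with the entry λ_i deleted. -/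
open Finset

theorem aux_zero {n : ℕ} (S : Finset (Fin n)) (l : Fin n → ℝ) : esymmOn S 0 l = 1 := by
  simp [esymmOn]

theorem aux_insert {n : ℕ} (S : Finset (Fin n)) (k : ℕ) (l : Fin n → ℝ) (i : Fin n)
    (hi : i ∉ S) : esymmOn (insert i S) (k+1) l = l i * esymmOn S k l + esymmOn S (k+1) l := by
  unfold esymmOn
  rw [Finset.powersetCard_succ_insert hi, Finset.sum_union, Finset.sum_image, Finset.mul_sum,
    add_comm]
  · congr 1
    refine Finset.sum_congr rfl fun s hs => ?_
    rw [Finset.prod_insert]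
    exact fun h => hi ((Finset.mem_powersetCard.1 hs).1 h)
  · intro s hs t ht h
    have h1 : i ∉ s := fun h => hi ((Finset.mem_powersetCard.1 hs).1 h)
    have h2 : i ∉ t := fun h => hi ((Finset.mem_powersetCard.1 ht).1 h)
    rw [← Finset.erase_insert h1, ← Finset.erase_insert h2]
    exact congrArg (fun u => u.erase i) h
  · rw [Finset.disjoint_left]
    intro s hs h
    obtain ⟨t, ht, rfl⟩ := Finset.mem_image.1 h
    exact hi ((Finset.mem_powersetCard.1 hs).1 (Finset.mem_insert_self i t))

theorem aux_erase {n : ℕ} (S : Finset (Fin n)) (k : ℕ) (l : Fin n → ℝ) (i : Fin n)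
    (hi : i ∈ S) :
    esymmOn S (k+1) l = l i * esymmOn (S.erase i) k l + esymmOn (S.erase i) (k+1) l := by
  rw [← aux_insert _ _ _ _ (Finset.notMem_erase i S), Finset.insert_erase hi]

theorem aux_euler {n : ℕ} (S : Finset (Fin n)) (l : Fin n → ℝ) : ∀ k : ℕ,
    ((k : ℝ) + 1) * esymmOn S (k+1) l = ∑ i ∈ S, l i * esymmOn (S.erase i) k l := by
  induction S using Finset.induction_on with
  | empty =>
    intro k
    rw [esymmOn, Finset.powersetCard_eq_empty.2 (by simp)]
    simp
  | insert a S ha ih =>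
    intro k
    rw [Finset.sum_insert ha, Finset.erase_insert ha, aux_insert _ _ _ _ ha]
    have e : ∀ i ∈ S, (insert a S).erase i = insert a (S.erase i) := by
      intro i hi
      exact Finset.erase_insert_of_ne (fun h => ha (h ▸ hi))
    cases k with
    | zero =>
      have := ih 0
      simp only [aux_zero] at this ⊢
      push_cast at this ⊢
      linarith
    | succ k =>
      have h1 := ih k
      have h2 := ih (k+1)
      have h3 : ∑ i ∈ S, l i * esymmOn ((insert a S).erase i) (k+1) l
          = l a * (∑ i ∈ S, l i * esymmOn (S.erase i) k l)
            + ∑ i ∈ S, l i * esymmOn (S.erase i) (k+1) l := by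
        rw [Finset.mul_sum, ← Finset.sum_add_distrib]
        refine Finset.sum_congr rfl fun i hi => ?_
        rw [e i hi, aux_insert _ _ _ _ (fun h => ha (Finset.mem_of_mem_erase h))]
        ring
      rw [h3, ← h1, ← h2]
      push_cast
      ring

/-- directional derivative of `σ_k` -/
noncomputable def dEsymm {n : ℕ} (S : Finset (Fin n)) (k : ℕ) (l m : Fin n → ℝ) : ℝ :=
  match k with
  | 0 => 0
  | k+1 => ∑ i ∈ S, m i * esymmOn (S.erase i) k l

theorem aux_derase {n : ℕ} (S : Finset (Fin n)) (k : ℕ) (l m : Fin n → ℝ) (i : Fin n)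
    (hi : i ∈ S) :
    dEsymm S (k+1) l m = m i * esymmOn (S.erase i) k l + l i * dEsymm (S.erase i) k l m
      + dEsymm (S.erase i) (k+1) l m := by
  cases k with
  | zero =>
    simp only [dEsymm, aux_zero, ← Finset.add_sum_erase S _ hi]
    ring
  | succ k =>
    simp only [dEsymm, ← Finset.add_sum_erase S _ hi]
    rw [Finset.mul_sum, add_assoc, ← Finset.sum_add_distrib]
    congr 1
    refine Finset.sum_congr rfl fun j hj => ?_
    rw [aux_erase (S.erase j) k l i
      (Finset.mem_erase.2 ⟨fun h => (Finset.ne_of_mem_erase hj) h.symm, hi⟩),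
      Finset.erase_right_comm]
    ring

theorem aux_deuler {n : ℕ} (S : Finset (Fin n)) (k : ℕ) (l m : Fin n → ℝ) :
    ((k : ℝ) + 1) * dEsymm S (k+1) l m
      = ∑ i ∈ S, (m i * esymmOn (S.erase i) k l + l i * dEsymm (S.erase i) k l m) := by
  cases k with
  | zero => simp [dEsymm]
  | succ k =>
    simp only [dEsymm, Finset.mul_sum, Finset.sum_add_distrib]
    have : ∑ i ∈ S, ∑ j ∈ S.erase i, l i * (m j * esymmOn ((S.erase i).erase j) k l)
        = ∑ j ∈ S, ((k:ℝ)+1) * (m j * esymmOn (S.erase j) (k+1) l) := by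
      rw [Finset.sum_comm' (t' := S) (s' := fun j => S.erase j)]
      · refine Finset.sum_congr rfl fun j hj => ?_
        have := aux_euler (S.erase j) l k
        rw [mul_left_comm, this, Finset.mul_sum]
        refine Finset.sum_congr rfl fun i hi => ?_
        rw [Finset.erase_right_comm]
        ring
      · intro x y
        simp only [Finset.mem_erase]
        tauto
    rw [this, ← Finset.sum_add_distrib]
    refine Finset.sum_congr rfl fun j hj => ?_
    push_cast
    ring

open Polynomial in
theorem aux_splits_deriv (p : ℝ[X]) (h : p.Splits) : (derivative p).Splits := by
  rw [splits_iff_card_roots] at h ⊢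
  have h1 := card_roots_le_derivative p
  have h2 := (derivative p).card_roots'
  have h3 := natDegree_derivative_le p
  by_cases h0 : p.natDegree = 0
  · have : derivative p = 0 := by
      rw [eq_C_of_natDegree_eq_zero h0]; simp
    simp [this]
  · omega

open Polynomial in
theorem aux_laguerre (p : ℝ[X]) (h : p.Splits) (x : ℝ) :
    p.eval x * (derivative (derivative p)).eval x ≤ ((derivative p).eval x)^2 := by
  obtain ⟨s, hs⟩ := splits_iff_exists_multiset.1 h
  have key : ∀ s : Multiset ℝ, ((s.map (fun a => X - C a)).prod).eval x *
      (derivative (derivative ((s.map (fun a => X - C a)).prod))).eval x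
      ≤ ((derivative ((s.map (fun a => X - C a)).prod)).eval x)^2 := by
    intro s
    induction s using Multiset.induction_on with
    | empty => simp
    | cons a s ih =>
      rw [Multiset.map_cons, Multiset.prod_cons]
      generalize (s.map (fun a => X - C a)).prod = g at ih
      simp only [derivative_mul, derivative_sub, derivative_X, derivative_C, derivative_add,
        eval_add, eval_mul, eval_sub, eval_X, eval_C, sub_zero, one_mul, derivative_one, eval_one]
      nlinarith [sq_nonneg (eval x g), mul_le_mul_of_nonneg_left ih (sq_nonneg (x - a))]
  have := key s
  rw [hs]
  simp only [derivative_C_mul, eval_mul, eval_C]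
  nlinarith [mul_le_mul_of_nonneg_left this (sq_nonneg p.leadingCoeff)]

open Polynomial in
theorem aux_newton {n : ℕ} (S : Finset (Fin n)) (k : ℕ) (l : Fin n → ℝ) :
    esymmOn S (k+2) l * esymmOn S k l ≤ (esymmOn S (k+1) l)^2 := by
  by_cases hk : k + 2 ≤ #S
  · obtain ⟨j, hj⟩ := Nat.exists_eq_add_of_le hk
    set P : ℝ[X] := ∏ i ∈ S, (X + C (l i)) with hP
    have hPs : P.Splits := Splits.prod fun i _ => Splits.X_add_C _
    have hd : ∀ j, (derivative^[j] P).Splits := by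
      intro j
      induction j with
      | zero => exact hPs
      | succ j ih =>
        rw [Function.iterate_succ_apply']
        exact aux_splits_deriv _ ih
    have hL := aux_laguerre _ (hd j) 0
    rw [← Function.iterate_succ_apply' (f := derivative),
      ← Function.iterate_succ_apply' (f := derivative)] at hL
    simp only [← coeff_zero_eq_eval_zero, coeff_iterate_derivative, zero_add,
      Nat.descFactorial_self, nsmul_eq_mul] at hL
    have c0 : P.coeff j = esymmOn S (k+2) l := by
      rw [hP, Finset.prod_X_add_C_coeff _ _ (by omega), esymmOn]
      congr 2; omega
    have c1 : P.coeff j.succ = esymmOn S (k+1) l := by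
      rw [hP, Finset.prod_X_add_C_coeff _ _ (by omega), esymmOn]
      congr 2; omega
    have c2 : P.coeff j.succ.succ = esymmOn S k l := by
      rw [hP, Finset.prod_X_add_C_coeff _ _ (by omega), esymmOn]
      congr 2; omega
    rw [c0, c1, c2] at hL
    simp only [Nat.succ_eq_add_one, Nat.factorial_succ] at hL
    push_cast at hL
    have hf : (0:ℝ) < (j.factorial : ℝ) := by exact_mod_cast j.factorial_pos
    have hj0 : (0:ℝ) ≤ j := Nat.cast_nonneg j
    generalize esymmOn S (k+2) l = a at *
    generalize esymmOn S (k+1) l = b at *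
    generalize esymmOn S k l = c at *
    generalize (j.factorial : ℝ) = f at *
    generalize (j : ℝ) = t at *
    have h1 : (f^2 * (t+1)) * ((t+2) * (a*c)) ≤ (f^2 * (t+1)) * ((t+1) * b^2) := by
      nlinarith
    have h2 := le_of_mul_le_mul_left h1 (by positivity)
    by_contra hc
    push Not at hc
    nlinarith [sq_nonneg b]
  · have : esymmOn S (k+2) l = 0 := by
      rw [esymmOn, Finset.powersetCard_eq_empty.2 (by omega)]; simp
    rw [this, zero_mul]
    positivity

def coneOn {n : ℕ} (S : Finset (Fin n)) (k : ℕ) (l : Fin n → ℝ) : Prop :=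
  ∀ j, j ≤ k → 0 < esymmOn S j l

theorem aux_cone {n : ℕ} (S : Finset (Fin n)) (k : ℕ) (l : Fin n → ℝ) (i : Fin n) (hi : i ∈ S)
    (h : coneOn S (k+1) l) : coneOn (S.erase i) k l := by
  intro j
  induction j with
  | zero => intro _; rw [aux_zero]; exact one_pos
  | succ j ih =>
    intro hj
    have h0 := ih (by omega)
    have h1 := h (j+1) (by omega)
    have h2 := h (j+2) (by omega)
    rw [aux_erase S _ l i hi] at h1 h2
    have hN := aux_newton (S.erase i) j l
    generalize esymmOn (S.erase i) (j+1) l = b at *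
    have e : j + 1 + 1 = j + 2 := rfl
    rw [e] at h2
    generalize esymmOn (S.erase i) (j+2) l = c at *
    generalize esymmOn (S.erase i) j l = a at *
    by_contra hb
    push Not at hb
    have h3 := mul_pos h2 h0
    have h4 := mul_nonneg h1.le (neg_nonneg.2 hb)
    nlinarith

theorem aux_alg (x y a b a' b' A B : ℝ) (ha : 0 < a) (hA : 0 < A) (hx : 0 < x * a + b)
    (hy : 0 < y * A + B) (ih : B / A ≤ (b' * a - b * a') / a^2) :
    y * B / (y * A + B) ≤
      ((y * b + x * b') * (x * a + b) - x * b * (y * a + x * a' + b')) / (x * a + b)^2 := by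
  obtain ⟨r, rfl⟩ : ∃ r, B = r * A := ⟨B / A, by field_simp⟩
  rw [mul_div_cancel_right₀ _ hA.ne', le_div_iff₀ (by positivity)] at ih
  have e : y * A + r * A = (y + r) * A := by ring
  rw [e] at hy ⊢
  have hyr : 0 < y + r := pos_of_mul_pos_left hy hA.le
  rw [← mul_assoc, mul_div_mul_right _ _ hA.ne', div_le_div_iff₀ hyr (by positivity)]
  have h1 := mul_le_mul_of_nonneg_left ih (mul_nonneg (sq_nonneg x) hyr.le)
  nlinarith [sq_nonneg (y * b - x * a * r)]

theorem aux_main {n : ℕ} (l m : Fin n → ℝ) : ∀ (k : ℕ) (S : Finset (Fin n)),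
    coneOn S k l → coneOn S k m →
    esymmOn S (k+1) m / esymmOn S k m ≤
      (dEsymm S (k+1) l m * esymmOn S k l - esymmOn S (k+1) l * dEsymm S k l m)
        / (esymmOn S k l)^2 := by
  intro k
  induction k with
  | zero =>
    intro S _ _
    have := aux_euler S m 0
    simp only [aux_zero, dEsymm] at this ⊢
    norm_num at this ⊢
    rw [this]
  | succ k ih =>
    intro S hl hm
    have hk : (0:ℝ) < (k:ℝ) + 2 := by positivity
    refine le_of_mul_le_mul_left ?_ hk
    have e1 := aux_euler S m (k+1)
    have e2 := aux_euler S l (k+1)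
    have e3 := aux_deuler S (k+1) l m
    have ec : (((k+1 : ℕ) : ℝ) + 1) = (k:ℝ) + 2 := by push_cast; ring
    rw [ec] at e1 e2 e3
    rw [← mul_div_assoc, ← mul_div_assoc, mul_sub, ← mul_assoc, ← mul_assoc, e1, e2, e3,
      Finset.sum_mul, Finset.sum_mul, ← Finset.sum_sub_distrib, Finset.sum_div, Finset.sum_div]
    refine Finset.sum_le_sum fun i hi => ?_
    have hl' := aux_cone S k l i hi hl
    have hm' := aux_cone S k m i hi hm
    have p1 := hl (k+1) le_rfl
    have p2 := hm (k+1) le_rfl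
    rw [aux_erase S k _ i hi] at p1 p2 
    rw [aux_erase S k l i hi, aux_erase S k m i hi, aux_derase S k l m i hi]
    exact aux_alg _ _ _ _ _ _ _ _ (hl' k le_rfl) (hm' k le_rfl) p1 p2 (ih _ hl' hm')

theorem aux_pow {n : ℕ} (l m : Fin n → ℝ) (S : Finset (Fin n)) : ∀ k : ℕ,
    coneOn S k l → coneOn S k m → 0 ≤ dEsymm S k l m ∧
    esymmOn S k m / esymmOn S k l ≤ (dEsymm S k l m / esymmOn S k l)^k := by
  intro k
  induction k with
  | zero => intro _ _; simp [dEsymm, aux_zero]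
  | succ k ih =>
    intro hl hm
    have hl' : coneOn S k l := fun j hj => hl j (by omega)
    have hm' : coneOn S k m := fun j hj => hm j (by omega)
    obtain ⟨i1, i2⟩ := ih hl' hm'
    have hM := aux_main l m k S hl' hm'
    have p1 := hl' k le_rfl
    have p2 := hm' k le_rfl
    have p3 := hl (k+1) le_rfl
    have p4 := hm (k+1) le_rfl
    generalize esymmOn S (k+1) l = b at *
    generalize esymmOn S k l = a at *
    generalize esymmOn S (k+1) m = B at *
    generalize esymmOn S k m = A at *
    generalize dEsymm S (k+1) l m = b' at *
    generalize dEsymm S k l m = a' at *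
    have hx : 0 < (B / A) / (b / a) := by positivity
    have hy : 0 ≤ a' / a := by positivity
    have key : a' / a + (B / A) / (b / a) ≤ b' / b := by
      have : (B / A) / (b / a) ≤ (b' * a - b * a') / a^2 / (b / a) := by gcongr
      have e : (b' * a - b * a') / a^2 / (b / a) = b' / b - a' / a := by
        field_simp
      linarith
    refine ⟨?_, ?_⟩
    · have : 0 ≤ b' / b := by linarith
      rw [le_div_iff₀ p3] at this
      linarith
    · calc B / b = (A / a) * ((B / A) / (b / a)) := by field_simp
        _ ≤ (a' / a)^k * ((B / A) / (b / a)) := by gcongr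
        _ ≤ (b' / b)^k * (b' / b) :=
            mul_le_mul (pow_le_pow_left₀ hy (by linarith) k) (by linarith) hx.le
              (pow_nonneg (by linarith) k)
        _ = (b' / b)^(k+1) := by ring

theorem garding_inequality (n k : ℕ) (hk1 : 1 ≤ k) (hkn : k ≤ n) :
    ∃ C : ℝ, 0 < C ∧ ∀ mu lam : Fin n → ℝ,
      mu ∈ GardingCone n k → lam ∈ GardingCone n k →
      ∑ i, mu i * esymmOn (Finset.univ.erase i) (k - 1) lam ≥
        C * (sigmaK n k mu) ^ ((1 : ℝ) / k) * (sigmaK n k lam) ^ (((k : ℝ) - 1) / k) := by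
  refine ⟨1, one_pos, fun mu lam hmu hlam => ?_⟩
  have hc : ∀ v : Fin n → ℝ, v ∈ GardingCone n k → coneOn Finset.univ k v := by
    intro v hv j hj
    rcases Nat.eq_zero_or_pos j with rfl | h
    · rw [aux_zero]; exact one_pos
    · exact hv j h hj
  obtain ⟨h0, h1⟩ := aux_pow lam mu Finset.univ k (hc _ hlam) (hc _ hmu)
  have hd : ∑ i, mu i * esymmOn (Finset.univ.erase i) (k - 1) lam
      = dEsymm Finset.univ k lam mu := by
    obtain ⟨k, rfl⟩ := Nat.exists_eq_add_of_le' hk1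
    rfl
  have q1 : 0 < sigmaK n k mu := hmu k hk1 le_rfl
  have q2 : 0 < sigmaK n k lam := hlam k hk1 le_rfl
  rw [hd, one_mul, ge_iff_le]
  change sigmaK n k mu / sigmaK n k lam ≤ (dEsymm Finset.univ k lam mu / sigmaK n k lam)^k at h1
  generalize sigmaK n k mu = A at *
  generalize sigmaK n k lam = a at *
  generalize dEsymm Finset.univ k lam mu = d at *
  have hk0 : (k:ℝ) ≠ 0 := by
    have : k ≠ 0 := by omega
    exact_mod_cast this
  have h2 := Real.rpow_le_rpow (by positivity) h1 (show (0:ℝ) ≤ 1 / k by positivity)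
  rw [one_div, Real.pow_rpow_inv_natCast (by positivity) (by omega),
    Real.div_rpow q1.le q2.le, div_le_div_iff₀ (by positivity) q2] at h2
  have e : ((k:ℝ) - 1) / k = 1 - (k:ℝ)⁻¹ := by field_simp
  rw [e, Real.rpow_sub q2, Real.rpow_one, one_div, ← mul_div_assoc, div_le_iff₀ (by positivity)]
  exact h2
end

section
/- Let 2 ≤ k ≤ n and let i ≠ j be indices in {1,…,n}. For every λ ∈ ℝ^n one has the polynomial identity σ_{k-1,i}(λ) · σ_{k-1,j}(λ) − σ_{k-2,ij}(λ) · σ_k(λ) = σ_{k-1,ij}(λ)² − σ_{k-2,ij}(λ) · σ_{k,ij}(λ). In particular, the inequality σ_{k-2,ij}(λ)σ_k(λ) ≤ σ_{k-1,i}(λ)σ_{k-1,j}(λ) is equivalent to σ_{k-2,ij}(λ)σ_{k,ij}(λ) ≤ σ_{k-1,ij}(λ)². -/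
open Finset

theorem esymmOn_erase_succ {n : ℕ} (S : Finset (Fin n)) (x : Fin n) (hx : x ∈ S) (m : ℕ)
    (lam : Fin n → ℝ) :
    esymmOn S (m + 1) lam = esymmOn (S.erase x) (m + 1) lam + lam x * esymmOn (S.erase x) m lam := by
  unfold esymmOn
  have hn : x ∉ S.erase x := Finset.notMem_erase x S
  conv_lhs => rw [← Finset.insert_erase hx, Finset.powersetCard_succ_insert hn]
  rw [Finset.sum_union, Finset.sum_image, Finset.mul_sum]
  · congr 1
    refine Finset.sum_congr rfl fun s hs => ?_
    rw [Finset.prod_insert]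
    exact fun h => hn ((Finset.mem_powersetCard.1 hs).1 h)
  · intro s hs t ht hst
    have h1 : x ∉ s := fun h => hn ((Finset.mem_powersetCard.1 hs).1 h)
    have h2 : x ∉ t := fun h => hn ((Finset.mem_powersetCard.1 ht).1 h)
    rw [← Finset.erase_insert h1, ← Finset.erase_insert h2]
    exact congrArg (fun u => Finset.erase u x) hst
  · rw [Finset.disjoint_left]
    intro s hs ht
    obtain ⟨t, _, rfl⟩ := Finset.mem_image.1 ht
    exact hn ((Finset.mem_powersetCard.1 hs).1 (Finset.mem_insert_self x t))

/-- the polynomial identity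
`σ_{k-1,i} σ_{k-1,j} − σ_{k-2,ij} σ_k = σ_{k-1,ij}² − σ_{k-2,ij} σ_{k,ij}`,
and the resulting equivalence of the two inequalities. -/
theorem sigma_del_identity (n k : ℕ) (hk2 : 2 ≤ k) (hkn : k ≤ n)
    (i j : Fin n) (hij : i ≠ j) (lam : Fin n → ℝ) :
    (esymmOn (Finset.univ.erase i) (k - 1) lam * esymmOn (Finset.univ.erase j) (k - 1) lam -
        esymmOn ((Finset.univ.erase i).erase j) (k - 2) lam * sigmaK n k lam =
      esymmOn ((Finset.univ.erase i).erase j) (k - 1) lam ^ 2 -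
        esymmOn ((Finset.univ.erase i).erase j) (k - 2) lam *
          esymmOn ((Finset.univ.erase i).erase j) k lam) ∧
    ((esymmOn ((Finset.univ.erase i).erase j) (k - 2) lam * sigmaK n k lam ≤
        esymmOn (Finset.univ.erase i) (k - 1) lam * esymmOn (Finset.univ.erase j) (k - 1) lam) ↔
      (esymmOn ((Finset.univ.erase i).erase j) (k - 2) lam *
          esymmOn ((Finset.univ.erase i).erase j) k lam ≤
        esymmOn ((Finset.univ.erase i).erase j) (k - 1) lam ^ 2)) := by
  obtain ⟨m, rfl⟩ : ∃ m, k = m + 2 := ⟨k - 2, by omega⟩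
  have e1 : m + 2 - 1 = m + 1 := rfl
  have e2 : m + 2 - 2 = m := rfl
  rw [e1, e2]
  have hji : j ∈ Finset.univ.erase i := Finset.mem_erase.2 ⟨hij.symm, Finset.mem_univ j⟩
  have hi' : i ∈ Finset.univ.erase j := Finset.mem_erase.2 ⟨hij, Finset.mem_univ i⟩
  have h1 := esymmOn_erase_succ _ j hji m lam
  have h2 := esymmOn_erase_succ _ i hi' m lam
  have h3 := esymmOn_erase_succ _ j hji (m + 1) lam
  have h4 := esymmOn_erase_succ _ i (Finset.mem_univ i) (m + 1) lam
  rw [Finset.erase_right_comm] at h2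
  have key : esymmOn (Finset.univ.erase i) (m + 1) lam * esymmOn (Finset.univ.erase j) (m + 1) lam -
        esymmOn ((Finset.univ.erase i).erase j) m lam * sigmaK n (m + 2) lam =
      esymmOn ((Finset.univ.erase i).erase j) (m + 1) lam ^ 2 -
        esymmOn ((Finset.univ.erase i).erase j) m lam *
          esymmOn ((Finset.univ.erase i).erase j) (m + 2) lam := by
    unfold sigmaK
    rw [h4, h3, h1, h2]
    ring
  refine ⟨key, ?_⟩
  rw [← sub_nonneg, key, sub_nonneg]
end

section
/- Let A and B be positive definite Hermitian n×n complex matrices. Then the trace of AB is a positive real number and satisfies tr(AB) ≥ n · (det A · det B)^{1/n}. -/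
open Finset

open scoped ComplexOrder

open scoped MatrixOrder in
lemma posdef_factor {n : ℕ} (A : Matrix (Fin n) (Fin n) ℂ) (hA : A.PosDef) :
    ∃ S : Matrix (Fin n) (Fin n) ℂ, A = star S * S :=
  CStarAlgebra.nonneg_iff_eq_star_mul_self.mp hA.posSemidef.nonneg

/-- for positive definite Hermitian complex matrices `A, B`, the trace of
`A * B` is a positive real number and `tr(AB) ≥ n (det A · det B)^{1/n}`. -/
theorem trace_mul_posdef (n : ℕ) (hn : 1 ≤ n) (A B : Matrix (Fin n) (Fin n) ℂ)
    (hA : A.PosDef) (hB : B.PosDef) :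
    0 < Complex.re (Matrix.trace (A * B)) ∧ Complex.im (Matrix.trace (A * B)) = 0 ∧
      Complex.re (Matrix.trace (A * B)) ≥
        (n : ℝ) * (Complex.re A.det * Complex.re B.det) ^ ((1 : ℝ) / n) := by
  obtain ⟨S, hS⟩ := posdef_factor A hA
  have hU : IsUnit S := by
    have h := hA.isUnit
    rw [hS, Matrix.isUnit_iff_isUnit_det, Matrix.det_mul] at h
    rw [Matrix.isUnit_iff_isUnit_det]
    exact isUnit_of_mul_isUnit_right h
  have hM : (S * B * star S).PosDef := (Matrix.IsUnit.posDef_star_right_conjugate_iff hU).mpr hB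
  have htr : Matrix.trace (A * B) = Matrix.trace (S * B * star S) := by
    rw [hS, Matrix.mul_assoc, Matrix.trace_mul_comm]
  have hdet : A.det * B.det = (S * B * star S).det := by
    rw [hS]; simp only [Matrix.det_mul]; ring
  set M := S * B * star S
  have e1 : Matrix.trace M = ((∑ i, hM.1.eigenvalues i : ℝ) : ℂ) := by
    rw [hM.1.trace_eq_sum_eigenvalues]; push_cast; rfl
  have e2 : M.det = ((∏ i, hM.1.eigenvalues i : ℝ) : ℂ) := by
    rw [hM.1.det_eq_prod_eigenvalues]; push_cast; rfl
  have hp := hM.eigenvalues_pos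
  have hA0 : A.det.im = 0 := (Complex.lt_def.mp hA.det_pos).2.symm
  have hre : A.det.re * B.det.re = ∏ i, hM.1.eigenvalues i := by
    have h := congrArg Complex.re (hdet.trans e2)
    rw [Complex.mul_re, hA0, Complex.ofReal_re] at h
    linarith
  have hn0 : (0 : ℝ) < n := by exact_mod_cast hn
  have : Nonempty (Fin n) := ⟨⟨0, hn⟩⟩
  rw [htr, hre, e1, Complex.ofReal_re, Complex.ofReal_im]
  refine ⟨Finset.sum_pos (fun i _ => hp i) Finset.univ_nonempty, rfl, ?_⟩
  have h := Real.geom_mean_le_arith_mean Finset.univ (fun _ => (1 : ℝ)) hM.1.eigenvalues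
    (by simp) (by simpa using hn0) (fun i _ => (hp i).le)
  simp only [Real.rpow_one, one_mul, Finset.sum_const, Finset.card_univ, Fintype.card_fin,
    nsmul_eq_mul, mul_one] at h
  rw [le_div_iff₀ hn0] at h
  rw [one_div, ge_iff_le, mul_comm]
  exact h
end
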